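/- Fix s ∈ [0, u_max] and C ≥ 0. (i) The constraint set {z ∈ 𝒞_b : g(s, z) ≤ −C} of the right-boundary stabilization problem is nonempty if and only if g(s, γ) ≤ −C, where γ = max(u*, û). (ii) If moreover g(s, (2u* + u_max)/4) ≤ −C, then z = (2u* + u_max)/4 belongs to the constraint set and minimizes z ↦ z² over it. -/

import Mathlib

/-- Feasibility of the right-boundary stabilization problem: for fixed
`s ∈ [0, u_max]` and `C ≥ 0`,
(i) the constraint set `{z ∈ 𝒞_b : g(s, z) ≤ -C}` is nonempty iff
`g(s, γ) ≤ -C` with `γ = max(u*, û)`;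
(ii) if moreover `g(s, (2u* + u_max)/4) ≤ -C`, then `z = (2u* + u_max)/4`
belongs to the constraint set and minimizes `z ↦ z²` over it. -/
theorem right_stabilization_feasibility
    (umax ustar uhat : ℝ) (f F : ℝ → ℝ) (g : ℝ → ℝ → ℝ)
    (humax : 0 < umax)
    (hustar : ustar ∈ Set.Icc (0 : ℝ) umax)
    (huhat : uhat = umax / 2)
    (hf : ∀ u : ℝ, f u = u * (1 - u / umax))
    (hF : ∀ u : ℝ, F u = u ^ 2 / 2 - u ^ 3 / (3 * umax))
    (hg : ∀ s z : ℝ, g s z = (s - ustar) * f s - (z - ustar) * f z - F s + F z) :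
    ∀ s ∈ Set.Icc (0 : ℝ) umax, ∀ C : ℝ, 0 ≤ C →
      ({z ∈ Set.Icc ((2 * ustar + umax) / 4) umax | g s z ≤ -C}.Nonempty ↔
        g s (max ustar uhat) ≤ -C) ∧
      (g s ((2 * ustar + umax) / 4) ≤ -C →
        (2 * ustar + umax) / 4 ∈
          {z ∈ Set.Icc ((2 * ustar + umax) / 4) umax | g s z ≤ -C} ∧
        ∀ z ∈ {z ∈ Set.Icc ((2 * ustar + umax) / 4) umax | g s z ≤ -C},
          ((2 * ustar + umax) / 4) ^ 2 ≤ z ^ 2) := by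
  subst huhat
  obtain ⟨h0, h1⟩ := hustar
  have hM : umax ≠ 0 := humax.ne'
  -- In either order of `u*` and `û`, `g s ·` minus its value at `γ` has a double root at `γ`.
  have hmin : ∀ s z : ℝ, (2 * ustar + umax) / 4 ≤ z →
      g s (max ustar (umax / 2)) ≤ g s z := by
    intro s z hz
    rcases le_total ustar (umax / 2) with h | h
    · rw [max_eq_right h, ← sub_nonneg]
      have key : g s z - g s (umax / 2) =
          (z - umax / 2) ^ 2 * (2 * z + umax / 2 - 3 * ustar) / (3 * umax) := by
        simp only [hg, hf, hF]
        field_simp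
        ring
      rw [key]
      exact div_nonneg (mul_nonneg (sq_nonneg _) (by linarith)) (by linarith)
    · rw [max_eq_left h, ← sub_nonneg]
      have key : g s z - g s ustar =
          (z - ustar) ^ 2 * (2 * z + ustar - 3 * (umax / 2)) / (3 * umax) := by
        simp only [hg, hf, hF]
        field_simp
        ring
      rw [key]
      exact div_nonneg (mul_nonneg (sq_nonneg _) (by linarith)) (by linarith)
  intro s _ C _
  refine ⟨⟨?_, fun h => ⟨max ustar (umax / 2), ⟨?_, ?_⟩, h⟩⟩, fun h => ⟨⟨⟨le_rfl, ?_⟩, h⟩, ?_⟩⟩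
  · rintro ⟨z, ⟨hz, _⟩, hgz⟩
    exact (hmin s z hz).trans hgz
  · linarith [le_max_left ustar (umax / 2), le_max_right ustar (umax / 2)]
  · exact max_le h1 (by linarith)
  · linarith
  · rintro z ⟨⟨hz, _⟩, _⟩
    exact pow_le_pow_left₀ (by linarith) hz 2
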